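/- arXiv:2109.04445 — 2 statements merged into one kernel-verified Lean document; each statement's English description precedes it below -/
import Mathlib

section
/- Let G be a finite abelian group and let L ∈ ℤ^{1×d} be a matrix all of whose coefficients are coprime to |G|. If d is even and L admits no canceling partition in G, then L is not fully common in G; that is, there exists a function f : G → [0,1] with t_L(f) + t_L(1−f) < (1/2)^{d−1}. -/
open Finset

variable {G : Type*} [AddCommGroup G] [Fintype G] [DecidableEq G]

/-- The configuration `C(L)` given by a matrix `L ∈ ℤ^{1×d}`: the kernel in `G^d` of the
induced map `v ↦ ∑ i, L 0 i • v i`. -/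
def config {d : ℕ} (L : Matrix (Fin 1) (Fin d) ℤ) : Finset (Fin d → G) :=
  Finset.univ.filter fun v => ∑ i, L 0 i • v i = 0

/-- The arithmetic multiplicity `t_L(f)`. -/
noncomputable def tL {d : ℕ} (L : Matrix (Fin 1) (Fin d) ℤ) (f : G → ℝ) : ℝ :=
  (∑ v ∈ config L, ∏ i, f (v i)) / ((config (G := G) L).card : ℝ)

/-- The average `E(f)` of `f` over `G`. -/
noncomputable def avg (f : G → ℝ) : ℝ := (∑ x, f x) / (Fintype.card G : ℝ)

/-- `L` admits a canceling partition in `G`: a partition of the index set into (distinct) pairs,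
encoded by a fixed-point-free involution `σ`, such that for each pair `{i, σ i}` the pair of
coefficients `(L 0 i, L 0 (σ i))` is canceling in `G`, i.e. their sum acts trivially on `G`. -/
def HasCancelingPartition (G : Type*) [AddCommGroup G] {d : ℕ}
    (L : Matrix (Fin 1) (Fin d) ℤ) : Prop :=
  ∃ σ : Equiv.Perm (Fin d), (∀ i, σ i ≠ i) ∧ (∀ i, σ (σ i) = i) ∧
    ∀ i, ∀ x : G, (L 0 i + L 0 (σ i)) • x = 0

/-- Balanced multiplicities yield a fixed-point-free involution negating the labels. -/
lemma exists_matching {M : Type*} [AddGroup M] [DecidableEq M] {d : ℕ} (l : Fin d → M)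
    (hne : ∀ i, -l i ≠ l i)
    (hbal : ∀ i, (univ.filter fun j => l j = l i).card = (univ.filter fun j => l j = -l i).card) :
    ∃ σ : Equiv.Perm (Fin d), (∀ i, σ i ≠ i) ∧ (∀ i, σ (σ i) = i) ∧ ∀ i, l (σ i) = -l i := by
  let r : Fin d → ℕ := fun i => (univ.filter fun j => l j = l i ∧ j < i).card
  have hlt : ∀ i j, l i = l j → i < j → r i < r j := by
    intro i j h hij
    apply Finset.card_lt_card
    rw [Finset.ssubset_iff_of_subset]
    · exact ⟨i, by simp [h, hij], by simp⟩
    · intro k hk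
      simp only [mem_filter, mem_univ, true_and] at hk ⊢
      exact ⟨hk.1.trans h, hk.2.trans hij⟩
  have hinj : ∀ i j, l i = l j → r i = r j → i = j := by
    intro i j h hr
    rcases lt_trichotomy i j with h1 | h1 | h1
    · exact absurd hr (hlt i j h h1).ne
    · exact h1
    · exact absurd hr (hlt j i h.symm h1).ne'
  have hrlt : ∀ i, r i < (univ.filter fun j => l j = l i).card := by
    intro i
    apply Finset.card_lt_card
    rw [Finset.ssubset_iff_of_subset]
    · exact ⟨i, by simp, by simp⟩
    · intro k hk
      simp only [mem_filter, mem_univ, true_and] at hk ⊢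
      exact hk.1
  have hex : ∀ i, ∃ j, l j = -l i ∧ r j = r i := by
    intro i
    have himg : (univ.filter fun j => l j = -l i).image r =
        range (univ.filter fun j => l j = -l i).card := by
      apply Finset.eq_of_subset_of_card_le
      · intro n hn
        simp only [mem_image, mem_filter, mem_univ, true_and] at hn
        obtain ⟨j, hj, rfl⟩ := hn
        have := hrlt j
        rw [hj] at this
        exact mem_range.2 this
      · rw [card_range, Finset.card_image_of_injOn]
        intro a ha b hb hab
        simp only [coe_filter, mem_univ, true_and, Set.mem_ofPred_eq] at ha hb
        exact hinj a b (ha.trans hb.symm) hab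
    have : r i ∈ range (univ.filter fun j => l j = -l i).card := by
      rw [mem_range, ← hbal i]; exact hrlt i
    rw [← himg] at this
    simpa using this
  choose s hs1 hs2 using hex
  have hss : ∀ i, s (s i) = i := by
    intro i
    apply hinj
    · rw [hs1, hs1, neg_neg]
    · rw [hs2, hs2]
  refine ⟨⟨s, s, hss, hss⟩, ?_, hss, hs1⟩
  intro i hi
  have h := hs1 i
  have hi' : s i = i := hi
  rw [hi'] at h
  exact hne i h.symm

lemma addChar_map_sum {H ι : Type*} [AddCommGroup H] (χ : AddChar H ℂ) (s : Finset ι)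
    (h : ι → H) : χ (∑ i ∈ s, h i) = ∏ i ∈ s, χ (h i) := by
  classical
  induction s using Finset.induction_on with
  | empty => simp
  | insert a s ha ih => rw [sum_insert ha, prod_insert ha, AddChar.map_add_eq_mul, ih]

/-- Fourier expansion of the count over the configuration. -/
lemma config_fourier {d : ℕ} (L : Matrix (Fin 1) (Fin d) ℤ) (F : G → ℂ) :
    (Fintype.card G : ℂ) * ∑ v ∈ config (G := G) L, ∏ i, F (v i) =
      ∑ χ : AddChar G ℂ, ∏ i, ∑ x, χ (L 0 i • x) * F x := by
  have h1 : ∀ χ : AddChar G ℂ, ∏ i, ∑ x, χ (L 0 i • x) * F x =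
      ∑ v : Fin d → G, χ (∑ i, L 0 i • v i) * ∏ i, F (v i) := by
    intro χ
    rw [Finset.prod_univ_sum, Fintype.piFinset_univ]
    refine Finset.sum_congr rfl fun v _ => ?_
    rw [Finset.prod_mul_distrib, addChar_map_sum]
  simp_rw [h1]
  rw [Finset.sum_comm]
  simp_rw [← Finset.sum_mul, AddChar.sum_apply_eq_ite]
  rw [config, Finset.sum_filter, Finset.mul_sum]
  refine Finset.sum_congr rfl fun v _ => ?_
  split_ifs <;> simp

/-- The generic characters: those killed only by integers that kill the whole group. -/
def genericChar (ψ : AddChar G ℂ) : Prop := ∀ k : ℤ, k • ψ = 0 → ∀ x : G, k • x = 0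

lemma exists_generic : ∃ ψ : AddChar G ℂ, genericChar ψ := by
  obtain ⟨ψ, hψ⟩ := AddMonoid.exists_addOrderOf_eq_exponent
    (AddMonoid.ExponentExists.of_finite (G := AddChar G ℂ))
  refine ⟨ψ, fun k hk x => ?_⟩
  rw [← AddChar.forall_apply_eq_zero]
  intro χ
  have h1 : (addOrderOf ψ : ℤ) ∣ k := addOrderOf_dvd_iff_zsmul_eq_zero.2 hk
  have h2 : (addOrderOf χ : ℤ) ∣ k := by
    refine dvd_trans ?_ h1
    rw [hψ]
    exact_mod_cast AddMonoid.addOrder_dvd_exponent χ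
  have h3 : k • χ = 0 := addOrderOf_dvd_iff_zsmul_eq_zero.1 h2
  have h4 := DFunLike.congr_fun h3 x
  rw [AddChar.map_zsmul_eq_zpow]
  simpa using h4

lemma zsmul_cancel_of_coprime {H : Type*} [AddCommGroup H] {N : ℕ} (hN : ∀ x : H, N • x = 0) {a : ℤ}
    (ha : IsCoprime a (N : ℤ)) {x : H} (hx : a • x = 0) : x = 0 := by
  obtain ⟨u, v, huv⟩ := ha
  have : (u * a + v * N) • x = x := by rw [huv, one_smul]
  rw [← this, add_smul, mul_smul, mul_smul, hx, natCast_zsmul, hN]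
  simp

lemma char_card_smul (ψ : AddChar G ℂ) : Fintype.card G • ψ = 0 := by
  rw [← AddChar.card_eq (α := G)]
  exact card_nsmul_eq_zero

lemma zsmul_comm' {H : Type*} [AddCommGroup H] (a b : ℤ) (x : H) : a • b • x = b • a • x := by
  rw [smul_comm]

lemma generic_smul {a : ℤ} (ha : IsCoprime a (Fintype.card G : ℤ)) (ψ : AddChar G ℂ) :
    genericChar (-(a • ψ)) ↔ genericChar ψ := by
  constructor
  · intro h k hk
    apply h
    rw [zsmul_neg, zsmul_comm', hk, zsmul_zero, neg_zero]
  · intro h k hk x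
    apply h
    apply zsmul_cancel_of_coprime (N := Fintype.card G) char_card_smul ha
    rw [zsmul_comm']
    rwa [zsmul_neg, neg_eq_zero] at hk

lemma generic_neg (ψ : AddChar G ℂ) : genericChar (-ψ) ↔ genericChar ψ := by
  simp [genericChar]

open Classical in
/-- Fourier coefficients with phases given by `φ`. -/
noncomputable def coef (N : ℕ) [NeZero N] (φ : AddChar G ℂ → ZMod N) (ψ : AddChar G ℂ) : ℂ :=
  if genericChar ψ then ZMod.stdAddChar (φ ψ - φ (-ψ)) else 0

lemma coef_neg (N : ℕ) [NeZero N] (φ : AddChar G ℂ → ZMod N) (ψ : AddChar G ℂ) :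
    coef N φ (-ψ) = (starRingEnd ℂ) (coef N φ ψ) := by
  unfold coef
  rw [generic_neg]
  split_ifs
  · rw [neg_neg, ← AddChar.map_neg_eq_conj, neg_sub]
  · simp

lemma coef_norm (N : ℕ) [NeZero N] (φ : AddChar G ℂ → ZMod N) (ψ : AddChar G ℂ) :
    ‖coef N φ ψ‖ ≤ 1 := by
  unfold coef
  split_ifs
  · rw [AddChar.norm_apply]
  · simp

/-- The relevant sum of products of Fourier coefficients. -/
noncomputable def coefSum {d : ℕ} (L : Matrix (Fin 1) (Fin d) ℤ) (N : ℕ) [NeZero N]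
    (φ : AddChar G ℂ → ZMod N) : ℂ := ∑ χ : AddChar G ℂ, ∏ i, coef N φ (-(L 0 i • χ))

/-- The phase homomorphism. -/
def phase {d : ℕ} (L : Matrix (Fin 1) (Fin d) ℤ) (N : ℕ) (χ : AddChar G ℂ) :
    (AddChar G ℂ → ZMod N) →+ ZMod N where
  toFun φ := ∑ i, (φ (-(L 0 i • χ)) - φ (L 0 i • χ))
  map_zero' := by simp
  map_add' φ φ' := by
    rw [← Finset.sum_add_distrib]
    refine Finset.sum_congr rfl fun i _ => ?_
    simp only [Pi.add_apply]; ring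

open Classical in
lemma coefSum_eq {d : ℕ} (hd0 : 0 < d) (L : Matrix (Fin 1) (Fin d) ℤ)
    (hcop : ∀ i, IsCoprime (L 0 i) (Fintype.card G : ℤ)) (N : ℕ) [NeZero N]
    (φ : AddChar G ℂ → ZMod N) :
    coefSum L N φ = ∑ χ ∈ univ.filter (fun χ : AddChar G ℂ => genericChar χ),
      (ZMod.stdAddChar (N := N)).compAddMonoidHom (phase L N χ) φ := by
  rw [coefSum, Finset.sum_filter]
  refine Finset.sum_congr rfl fun χ _ => ?_
  split_ifs with h
  · rw [AddChar.compAddMonoidHom_apply]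
    simp only [phase, AddMonoidHom.coe_mk, ZeroHom.coe_mk]
    rw [addChar_map_sum]
    refine Finset.prod_congr rfl fun i _ => ?_
    rw [coef, if_pos ((generic_smul (hcop i) χ).2 h), neg_neg]
  · apply Finset.prod_eq_zero (Finset.mem_univ (⟨0, hd0⟩ : Fin d))
    rw [coef, if_neg]
    rwa [generic_smul (hcop _)]

lemma exists_neg {d : ℕ} (hd0 : 0 < d) (L : Matrix (Fin 1) (Fin d) ℤ)
    (hcop : ∀ i, IsCoprime (L 0 i) (Fintype.card G : ℤ)) (a : Fin d)
    (ha : (univ.filter fun j => ∀ x : G, (L 0 j - L 0 a) • x = 0).card ≠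
      (univ.filter fun j => ∀ x : G, (L 0 j + L 0 a) • x = 0).card) :
    ∃ φ : AddChar G ℂ → ZMod (d + 1), (coefSum L (d + 1) φ).re < 0 := by
  classical
  have hsum : ∑ φ : AddChar G ℂ → ZMod (d + 1), coefSum L (d + 1) φ = 0 := by
    simp_rw [coefSum_eq hd0 L hcop]
    rw [Finset.sum_comm]
    apply Finset.sum_eq_zero
    intro χ hχ
    simp only [mem_filter, mem_univ, true_and] at hχ
    rw [AddChar.sum_eq_zero_iff_ne_zero, AddChar.ne_zero_iff]
    refine ⟨Pi.single (L 0 a • χ) 1, ?_⟩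
    rw [AddChar.compAddMonoidHom_apply]
    intro h
    rw [← AddChar.map_zero_eq_one (ZMod.stdAddChar (N := d + 1)),
      ZMod.injective_stdAddChar.eq_iff] at h
    simp only [phase, AddMonoidHom.coe_mk, ZeroHom.coe_mk, Finset.sum_sub_distrib, Pi.single_apply,
      Finset.sum_boole] at h
    have key : ∀ k : ℤ, k • χ = 0 ↔ ∀ x : G, k • x = 0 := by
      intro k
      refine ⟨hχ k, fun hk => ?_⟩
      ext x
      rw [AddChar.zsmul_apply, ← AddChar.map_zsmul_eq_zpow, hk]
      simp
    have e1 : ∀ j, (-(L 0 j • χ) = L 0 a • χ) ↔ ∀ x : G, (L 0 j + L 0 a) • x = 0 := by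
      intro j
      rw [← key, add_zsmul, neg_eq_iff_add_eq_zero]
    have e2 : ∀ j, (L 0 j • χ = L 0 a • χ) ↔ ∀ x : G, (L 0 j - L 0 a) • x = 0 := by
      intro j
      rw [← key, sub_zsmul, add_neg_eq_zero]
    simp only [e1, e2] at h
    rw [sub_eq_zero, ZMod.natCast_eq_natCast_iff'] at h
    have b : ∀ s : Finset (Fin d), s.card % (d + 1) = s.card := by
      intro s
      apply Nat.mod_eq_of_lt
      have := Finset.card_le_univ s
      simp only [Fintype.card_fin] at this
      omega
    rw [b, b] at h
    apply ha
    convert h.symm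
  by_contra! hcon
  have hre : ∑ φ : AddChar G ℂ → ZMod (d + 1), (coefSum L (d + 1) φ).re = 0 := by
    rw [← Complex.re_sum, hsum]; rfl
  have h0 := (Finset.sum_eq_zero_iff_of_nonneg (fun φ _ => hcon φ)).1 hre 0 (mem_univ _)
  rw [coefSum_eq hd0 L hcop] at h0
  simp only [AddChar.map_zero_eq_one, Finset.sum_const, nsmul_eq_mul, mul_one,
    Complex.natCast_re, Nat.cast_eq_zero, Finset.card_eq_zero] at h0
  obtain ⟨ψ, hψ⟩ := exists_generic (G := G)
  have : ψ ∈ univ.filter (fun χ : AddChar G ℂ => genericChar χ) := by simpa using hψ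
  rw [h0] at this
  simp at this

/-- The function with Fourier coefficients `coef`. -/
noncomputable def gfun (N : ℕ) [NeZero N] (φ : AddChar G ℂ → ZMod N) (x : G) : ℝ :=
  (∑ ψ : AddChar G ℂ, coef N φ ψ * ψ x).re

lemma gfun_coe (N : ℕ) [NeZero N] (φ : AddChar G ℂ → ZMod N) (x : G) :
    (gfun N φ x : ℂ) = ∑ ψ : AddChar G ℂ, coef N φ ψ * ψ x := by
  unfold gfun
  rw [← Complex.conj_eq_iff_re, map_sum]
  refine Fintype.sum_equiv (Equiv.neg _) _ _ fun ψ => ?_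
  rw [map_mul, Equiv.neg_apply, coef_neg, AddChar.neg_apply, AddChar.map_neg_eq_conj]

lemma gfun_abs (N : ℕ) [NeZero N] (φ : AddChar G ℂ → ZMod N) (x : G) :
    |gfun N φ x| ≤ Fintype.card G := by
  refine (Complex.abs_re_le_norm _).trans ((norm_sum_le _ _).trans ?_)
  calc ∑ ψ : AddChar G ℂ, ‖coef N φ ψ * ψ x‖ ≤ ∑ ψ : AddChar G ℂ, (1 : ℝ) := by
        refine Finset.sum_le_sum fun ψ _ => ?_
        rw [norm_mul, AddChar.norm_apply, mul_one]
        exact coef_norm N φ ψ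
    _ = Fintype.card G := by simp

lemma gfun_fourier (N : ℕ) [NeZero N] (φ : AddChar G ℂ → ZMod N) (χ : AddChar G ℂ) (a : ℤ) :
    ∑ x, χ (a • x) * (gfun N φ x : ℂ) = Fintype.card G * coef N φ (-(a • χ)) := by
  simp_rw [gfun_coe, Finset.mul_sum]
  rw [Finset.sum_comm]
  have : ∀ ψ : AddChar G ℂ, ∑ x, χ (a • x) * (coef N φ ψ * ψ x) =
      if ψ = -(a • χ) then Fintype.card G * coef N φ ψ else 0 := by
    intro ψ
    have h1 : ∀ x, χ (a • x) * (coef N φ ψ * ψ x) = coef N φ ψ * (ψ + a • χ) x := by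
      intro x
      rw [AddChar.add_apply, AddChar.zsmul_apply, AddChar.map_zsmul_eq_zpow]; ring
    simp_rw [h1]
    rw [← Finset.mul_sum, AddChar.sum_eq_ite]
    simp only [eq_neg_iff_add_eq_zero]
    split_ifs <;> ring
  simp_rw [this]
  simp

lemma count_formula {d : ℕ} (hd0 : 0 < d) (L : Matrix (Fin 1) (Fin d) ℤ)
    (hcop : ∀ i, IsCoprime (L 0 i) (Fintype.card G : ℤ)) (h0 : ¬ genericChar (0 : AddChar G ℂ))
    (N : ℕ) [NeZero N] (φ : AddChar G ℂ → ZMod N) (δ : ℝ) :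
    (Fintype.card G : ℝ) * ∑ v ∈ config (G := G) L, ∏ i, (1 / 2 + δ * gfun N φ (v i)) =
      (Fintype.card G / 2 : ℝ) ^ d + (δ * Fintype.card G) ^ d * (coefSum L N φ).re := by
  have hc : (Fintype.card G : ℂ) * ∑ v ∈ config (G := G) L,
      ∏ i, (1 / 2 + (δ : ℂ) * (gfun N φ (v i) : ℂ)) =
      (Fintype.card G / 2 : ℂ) ^ d + (δ * Fintype.card G) ^ d * coefSum L N φ := by
    rw [config_fourier L (fun x => 1 / 2 + (δ : ℂ) * (gfun N φ x : ℂ))]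
    have h1 : ∀ (χ : AddChar G ℂ) (i : Fin d),
        ∑ x, χ (L 0 i • x) * (1 / 2 + (δ : ℂ) * (gfun N φ x : ℂ)) =
        (if χ = 0 then (Fintype.card G / 2 : ℂ) else 0) +
          (δ * Fintype.card G) * coef N φ (-(L 0 i • χ)) := by
      intro χ i
      have e : ∀ x, χ (L 0 i • x) * (1 / 2 + (δ : ℂ) * (gfun N φ x : ℂ)) =
        (1 / 2) * (L 0 i • χ) x + δ * (χ (L 0 i • x) * (gfun N φ x : ℂ)) := by
        intro x
        rw [AddChar.zsmul_apply, AddChar.map_zsmul_eq_zpow]; ring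
      simp_rw [e]
      rw [Finset.sum_add_distrib, ← Finset.mul_sum, ← Finset.mul_sum, gfun_fourier,
        AddChar.sum_eq_ite]
      have : L 0 i • χ = 0 ↔ χ = 0 :=
        ⟨zsmul_cancel_of_coprime (N := Fintype.card G) char_card_smul (hcop i),
          fun h => by rw [h, zsmul_zero]⟩
      simp only [this]
      split_ifs <;> ring
    have h2 : ∀ χ : AddChar G ℂ,
        ∏ i, ∑ x, χ (L 0 i • x) * (1 / 2 + (δ : ℂ) * (gfun N φ x : ℂ)) =
        (if χ = 0 then (Fintype.card G / 2 : ℂ) ^ d else 0) +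
          (δ * Fintype.card G) ^ d * ∏ i, coef N φ (-(L 0 i • χ)) := by
      intro χ
      simp_rw [h1]
      by_cases hχ : χ = 0
      · subst hχ
        simp [coef, h0, hd0.ne', zsmul_zero, div_pow]
      · simp [hχ, Finset.prod_mul_distrib]
    simp_rw [h2]
    rw [Finset.sum_add_distrib, ← Finset.mul_sum, coefSum]
    simp
  have := congrArg Complex.re hc
  have e1 : (Fintype.card G : ℂ) * ∑ v ∈ config (G := G) L,
      ∏ i, (1 / 2 + (δ : ℂ) * (gfun N φ (v i) : ℂ)) =
      (((Fintype.card G : ℝ) * ∑ v ∈ config (G := G) L,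
        ∏ i, (1 / 2 + δ * gfun N φ (v i)) : ℝ) : ℂ) := by push_cast; rfl
  have e2 : (Fintype.card G / 2 : ℂ) ^ d + (δ * Fintype.card G) ^ d * coefSum L N φ =
      (((Fintype.card G / 2 : ℝ) ^ d : ℝ) : ℂ) + (((δ * Fintype.card G) ^ d : ℝ) : ℂ) *
        coefSum L N φ := by push_cast; rfl
  rw [e1, e2, Complex.ofReal_re, Complex.add_re, Complex.ofReal_re, Complex.re_ofReal_mul] at this
  exact this

/-- If all coefficients of `L ∈ ℤ^{1×d}` are coprime to `|G|`, `d` is even and `L` admits no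
canceling partition in `G`, then `L` is not fully common in `G`. -/
theorem single_equation_no_partition_not_fully_common {d : ℕ} (L : Matrix (Fin 1) (Fin d) ℤ)
    (hcop : ∀ i, IsCoprime (L 0 i) (Fintype.card G : ℤ))
    (hd : Even d) (hpart : ¬ HasCancelingPartition G L) :
    ∃ f : G → ℝ, (∀ x, f x ∈ Set.Icc (0 : ℝ) 1) ∧
      tL L f + tL L (fun x => 1 - f x) < (1 / 2 : ℝ) ^ (d - 1) := by
  have hGc : ∀ x : G, Fintype.card G • x = 0 := fun x => card_nsmul_eq_zero
  -- 2 does not kill `G`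
  have h2 : ¬ ∀ x : G, (2 : ℤ) • x = 0 := by
    intro h2
    apply hpart
    refine ⟨Fin.revPerm, ?_, ?_, ?_⟩
    · intro i hi
      obtain ⟨m, hm⟩ := hd
      have := congrArg Fin.val hi
      simp only [Fin.revPerm_apply, Fin.val_rev] at this
      omega
    · intro i; simp
    · intro i x
      have hodd : ∀ j, L 0 j • x = x := by
        intro j
        rcases Int.even_or_odd' (L 0 j) with ⟨k, hk | hk⟩
        · have : L 0 j • x = 0 := by rw [hk, mul_comm, mul_smul, h2, smul_zero]
          rw [this]
          exact (zsmul_cancel_of_coprime hGc (hcop j) this).symm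
        · rw [hk, add_smul, mul_comm, mul_smul, h2, smul_zero, zero_add, one_smul]
      rw [add_smul, hodd, hodd, ← h2 x, two_smul]
  have hd0 : 0 < d := by
    rcases Nat.eq_zero_or_pos d with rfl | h
    · exact absurd ⟨Equiv.refl _, fun i => i.elim0, fun i => i.elim0, fun i => i.elim0⟩ hpart
    · exact h
  have h0 : ¬ genericChar (0 : AddChar G ℂ) := fun h => h2 fun x => h 2 (zsmul_zero _) x
  have hunb : ∃ a : Fin d, (univ.filter fun j => ∀ x : G, (L 0 j - L 0 a) • x = 0).card ≠
      (univ.filter fun j => ∀ x : G, (L 0 j + L 0 a) • x = 0).card := by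
    by_contra! hbal
    apply hpart
    let l : Fin d → (G → G) := fun i x => L 0 i • x
    have e1 : ∀ i j, l j = l i ↔ ∀ x : G, (L 0 j - L 0 i) • x = 0 := by
      intro i j
      simp only [l, funext_iff, sub_smul, sub_eq_zero]
    have e2 : ∀ i j, l j = -l i ↔ ∀ x : G, (L 0 j + L 0 i) • x = 0 := by
      intro i j
      simp only [l, funext_iff, add_smul, eq_neg_iff_add_eq_zero, Pi.add_apply, Pi.zero_apply]
    obtain ⟨σ, s1, s2, s3⟩ := exists_matching l (by
      intro i hi
      apply h2
      intro x
      have := (e2 i i).1 hi.symm x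
      rw [← two_mul, mul_comm, mul_smul] at this
      exact zsmul_cancel_of_coprime hGc (hcop i) this) (by
      intro i
      simp only [e1, e2]
      convert hbal i)
    refine ⟨σ, s1, s2, fun i x => ?_⟩
    rw [add_comm]
    exact (e2 i (σ i)).1 (s3 i) x
  obtain ⟨a, ha⟩ := hunb
  obtain ⟨φ, hφ⟩ := exists_neg hd0 L hcop a ha
  have hn : (0 : ℝ) < Fintype.card G := by exact_mod_cast Fintype.card_pos
  set n : ℝ := (Fintype.card G : ℝ) with hndef
  set δ : ℝ := 1 / (2 * n) with hδ
  have hδ0 : 0 < δ := by positivity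
  have hbd : ∀ x, |δ * gfun (d + 1) φ x| ≤ 1 / 2 := by
    intro x
    rw [abs_mul, abs_of_pos hδ0]
    calc δ * |gfun (d + 1) φ x| ≤ δ * n := by
          gcongr; exact gfun_abs _ _ _
      _ = 1 / 2 := by rw [hδ]; field_simp
  have F1 := count_formula hd0 L hcop h0 (d + 1) φ δ
  have F2 := count_formula hd0 L hcop h0 (d + 1) φ (-δ)
  have F3 := count_formula hd0 L hcop h0 (d + 1) φ 0
  refine ⟨fun x => 1 / 2 + δ * gfun (d + 1) φ x, fun x => ?_, ?_⟩
  · have := abs_le.1 (hbd x)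
    constructor <;> linarith [this.1, this.2]
  · have e : (fun x => 1 - (1 / 2 + δ * gfun (d + 1) φ x)) =
        fun x => 1 / 2 + (-δ) * gfun (d + 1) φ x := by
      funext x; ring
    rw [show (fun x : G => 1 - (fun x => 1 / 2 + δ * gfun (d + 1) φ x) x) =
      fun x => 1 / 2 + (-δ) * gfun (d + 1) φ x from e]
    simp only [tL]
    rw [← hndef] at F1 F2 F3
    have hneg : (-δ * n) ^ d = (δ * n) ^ d := by rw [neg_mul, hd.neg_pow]
    rw [hneg] at F2
    simp only [zero_mul, add_zero, Finset.prod_const, Finset.card_univ, Fintype.card_fin,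
      Finset.sum_const, nsmul_eq_mul, zero_pow hd0.ne'] at F3
    set X := ∑ v ∈ config (G := G) L, ∏ i, (1 / 2 + δ * gfun (d + 1) φ (v i))
    set Y := ∑ v ∈ config (G := G) L, ∏ i, (1 / 2 + -δ * gfun (d + 1) φ (v i))
    set C : ℝ := ((config (G := G) L).card : ℝ)
    have hC : 0 < C := by
      have : 0 < n * (C * (1 / 2) ^ d) := by rw [F3]; positivity
      by_contra! hC
      have : n * (C * (1 / 2) ^ d) ≤ 0 :=
        mul_nonpos_of_nonneg_of_nonpos hn.le
          (mul_nonpos_of_nonpos_of_nonneg hC (by positivity))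
      linarith
    rw [← add_div, div_lt_iff₀ hC]
    have hT : (δ * n) ^ d * (coefSum L (d + 1) φ).re < 0 :=
      mul_neg_of_pos_of_neg (by positivity) hφ
    have hp : (1 / 2 : ℝ) ^ d = (1 / 2) ^ (d - 1) * (1 / 2) := by
      rw [← pow_succ, Nat.sub_add_cancel hd0]
    rw [hp] at F3
    have : n * (X + Y) < n * ((1 / 2) ^ (d - 1) * C) := by nlinarith
    exact lt_of_mul_lt_mul_left this hn.le
end

section
/- Let G be a finite abelian group with |G| > 1 and let L ∈ ℤ^{1×d} be a matrix all of whose coefficients are coprime to |G|. If L admits no canceling partition in G (in particular this holds whenever d is odd), then there exists a function f : G → [0,1] with E(f) = 1/2 such that t_L(f) ≤ (1/2)^d − 1/(2^{3d+1}·√2·d^{2d}). -/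
open Finset

variable {G : Type*} [AddCommGroup G] [Fintype G] [DecidableEq G]

section helpers

/-- Existence of a good phase parameter. -/
lemma exists_phase {ι : Type*} (T : Finset ι) (K : ι → ℤ) (hK : ∀ i ∈ T, K i ≠ 0)
    (i0 : ι) (h0 : i0 ∈ T) : ∃ t : ℝ, ∑ i ∈ T, Real.cos (K i * t) ≤ -(1/4) := by
  have I : ∀ k : ℤ, ∫ t in (0:ℝ)..(2 * Real.pi), Real.cos (k * t) =
      if k = 0 then 2 * Real.pi else 0 := by
    intro k
    split_ifs with h
    · simp [h]
    · have hk : (k : ℝ) ≠ 0 := by exact_mod_cast h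
      rw [intervalIntegral.integral_comp_mul_left (fun x => Real.cos x) hk, integral_cos]
      have : Real.sin (k * (2 * Real.pi)) = 0 := by
        have := Real.sin_int_mul_pi (k * 2)
        push_cast at this
        rw [← this]; ring_nf
      simp [this]
  by_contra! hcon
  have hpi := Real.pi_pos
  have key : ∫ t in (0:ℝ)..(2 * Real.pi),
      (1 - Real.cos (K i0 * t)) * (∑ i ∈ T, Real.cos (K i * t) + 1/4) =
      (2 * Real.pi) / 4 - ∑ i ∈ T, ((if K i0 + K i = 0 then 2 * Real.pi else 0)
        + (if K i0 - K i = 0 then 2 * Real.pi else 0)) / 2 := by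
    have e : ∀ t : ℝ, (1 - Real.cos (K i0 * t)) * (∑ i ∈ T, Real.cos (K i * t) + 1/4)
        = ∑ i ∈ T, Real.cos (K i * t) + 1/4 - (1/4) * Real.cos (K i0 * t)
          - ∑ i ∈ T, (Real.cos ((K i0 + K i : ℤ) * t) + Real.cos ((K i0 - K i : ℤ) * t)) / 2 := by
      intro t
      have : ∀ i, (Real.cos ((K i0 + K i : ℤ) * t) + Real.cos ((K i0 - K i : ℤ) * t)) / 2
          = Real.cos (K i0 * t) * Real.cos (K i * t) := by
        intro i
        push_cast
        rw [add_mul, sub_mul, Real.cos_add, Real.cos_sub]; ring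
      simp_rw [this, ← Finset.mul_sum]
      ring
    simp_rw [e]
    rw [intervalIntegral.integral_sub, intervalIntegral.integral_sub,
      intervalIntegral.integral_add, intervalIntegral.integral_finsetSum,
      intervalIntegral.integral_finsetSum, intervalIntegral.integral_const_mul, I]
    · simp_rw [intervalIntegral.integral_div]
      have : ∀ i, ∫ t in (0:ℝ)..(2 * Real.pi), (Real.cos ((K i0 + K i : ℤ) * t) +
          Real.cos ((K i0 - K i : ℤ) * t)) = ((if K i0 + K i = 0 then 2 * Real.pi else 0)
        + (if K i0 - K i = 0 then 2 * Real.pi else 0)) := by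
        intro i
        rw [intervalIntegral.integral_add, I, I]
        all_goals exact Continuous.intervalIntegrable (by fun_prop) _ _
      simp_rw [this, I]
      rw [Finset.sum_eq_zero (s := T) (f := fun i => if K i = 0 then 2 * Real.pi else 0)
        (fun i hi => by simp [hK i hi])]
      simp [hK i0 h0]
      try ring
    all_goals intros
    all_goals exact Continuous.intervalIntegrable (by fun_prop) _ _
  have hpos : 0 ≤ ∫ t in (0:ℝ)..(2 * Real.pi),
      (1 - Real.cos (K i0 * t)) * (∑ i ∈ T, Real.cos (K i * t) + 1/4) := by
    apply intervalIntegral.integral_nonneg (by positivity)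
    intro t _
    apply mul_nonneg
    · linarith [Real.cos_le_one (K i0 * t)]
    · linarith [hcon t]
  have hs : Real.pi ≤ ∑ i ∈ T, ((if K i0 + K i = 0 then 2 * Real.pi else 0)
        + (if K i0 - K i = 0 then 2 * Real.pi else 0)) / 2 := by
    refine le_trans ?_ (Finset.single_le_sum (f := fun i =>
      ((if K i0 + K i = 0 then 2 * Real.pi else 0)
        + (if K i0 - K i = 0 then 2 * Real.pi else 0)) / 2) ?_ h0)
    · simp only [sub_self, if_true]
      split_ifs <;> linarith
    · intro i _
      positivity
  rw [key] at hpos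
  linarith

/-- A generic odd integer weight detects pairings. -/
lemma exists_weight {D : Type*} [AddCommGroup D] [Fintype D] (d : ℕ) :
    ∃ k : D → ℤ, (∀ ψ, k (-ψ) = - k ψ) ∧ ∀ v : Fin d → D, (∀ i, v i ≠ - v i) →
      ∑ i, k (v i) = 0 → ∃ σ : Equiv.Perm (Fin d), (∀ i, σ i ≠ i) ∧ (∀ i, σ (σ i) = i) ∧
        ∀ i, v (σ i) = - v i := by
  classical
  let e := Fintype.equivFin D
  let N := Fintype.card D
  refine ⟨fun ψ => ((d+1 : ℕ) : ℤ)^(e ψ : ℕ) - ((d+1 : ℕ) : ℤ)^(e (-ψ) : ℕ), fun ψ => by simp,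
    fun v hv hs => ?_⟩
  -- counts
  let c : D → ℕ := fun ψ => (univ.filter fun i => v i = ψ).card
  have hc : ∀ ψ, c ψ < d + 1 := fun ψ => by
    have := Finset.card_le_univ (univ.filter fun i => v i = ψ)
    simp at this
    exact Nat.lt_succ_of_le this
  have sum1 : ∀ w : Fin d → D, ∑ i, (d+1)^(e (w i) : ℕ) =
      ∑ j : Fin N, (univ.filter fun i => w i = e.symm j).card * (d+1)^(j : ℕ) := by
    intro w
    rw [← Finset.sum_fiberwise (s := univ) (g := fun i => e (w i))]
    refine Finset.sum_congr rfl fun j _ => ?_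
    rw [Finset.sum_congr rfl (g := fun _ => (d+1)^(j:ℕ))]
    · rw [Finset.sum_const, smul_eq_mul]
      congr 3
      ext i
      simp [Equiv.eq_symm_apply]
    · intro i hi
      simp at hi
      rw [hi]
  have hcc : ∀ ψ, c ψ = c (-ψ) := by
    have hnat : ∑ i, (d+1)^(e (v i) : ℕ) = ∑ i, (d+1)^(e (- v i) : ℕ) := by
      have : (∑ i, ((d+1 : ℕ) : ℤ)^(e (v i) : ℕ)) = ∑ i, ((d+1 : ℕ) : ℤ)^(e (-v i) : ℕ) := by
        rw [← sub_eq_zero, ← Finset.sum_sub_distrib]; exact hs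
      exact_mod_cast this
    rw [sum1, sum1 (fun i => - v i)] at hnat
    have hneg : ∀ ψ, (univ.filter fun i => - v i = ψ) = (univ.filter fun i => v i = -ψ) := by
      intro ψ; ext i; simp [neg_eq_iff_eq_neg]
    simp_rw [hneg] at hnat
    have hf : (fun j : Fin N => (⟨c (e.symm j), hc _⟩ : Fin (d+1))) =
        (fun j : Fin N => (⟨c (-e.symm j), hc _⟩ : Fin (d+1))) := by
      apply finFunctionFinEquiv.injective
      apply Fin.ext
      rw [finFunctionFinEquiv_apply, finFunctionFinEquiv_apply]
      exact hnat
    intro ψ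
    have := congrFun hf (e ψ)
    simpa using this
  let P : Fin d → Prop := fun i => e (v i) < e (- v i)
  have hfib : ∀ ψ : D, Nonempty ({a : {i // P i} // v a = ψ} ≃ {b : {i // ¬ P i} // - v b = ψ}) := by
    intro ψ
    by_cases h : e ψ < e (-ψ)
    · have e1 : {a : {i // P i} // v a = ψ} ≃ {i // v i = ψ} :=
        (Equiv.subtypeSubtypeEquivSubtype (p := P) (q := fun i => v i = ψ)
          (fun {i} hi => by simp only [P]; rw [hi]; exact h))
      have e2 : {b : {i // ¬ P i} // - v b = ψ} ≃ {i // v i = -ψ} :=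
        ((Equiv.subtypeSubtypeEquivSubtype (p := fun i => ¬ P i) (q := fun i => - v i = ψ)
          (fun {i} hi => by
            simp only [P]; rw [hi, neg_eq_iff_eq_neg.1 hi]; exact not_lt.2 h.le))).trans
          (Equiv.subtypeEquivRight fun i => neg_eq_iff_eq_neg)
      have e3 : {i // v i = ψ} ≃ {i // v i = -ψ} := by
        apply Fintype.equivOfCardEq
        rw [Fintype.card_subtype, Fintype.card_subtype]
        exact hcc ψ
      exact ⟨e1.trans (e3.trans e2.symm)⟩
    · have : IsEmpty {a : {i // P i} // v a = ψ} :=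
        ⟨fun a => h (by have := a.1.2; simp only [P] at this; rwa [a.2] at this)⟩
      have : IsEmpty {b : {i // ¬ P i} // - v b = ψ} := by
        refine ⟨fun b => ?_⟩
        have h1 := b.1.2
        simp only [P] at h1
        rw [b.2, neg_eq_iff_eq_neg.1 b.2] at h1
        have h2 : e ψ = e (-ψ) := le_antisymm (not_lt.1 h1) (not_lt.1 h)
        have h3 := e.injective h2
        have h4 := b.2
        apply hv b.1
        rw [h4, neg_eq_iff_eq_neg.1 b.2]; exact h3.symm
      exact ⟨Equiv.equivOfIsEmpty _ _⟩
  let E := fun ψ => (hfib ψ).some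
  let τ : {i // P i} ≃ {i // ¬ P i} := Equiv.ofFiberEquiv E
  have hτ : ∀ a, - v (τ a) = v a := Equiv.ofFiberEquiv_map E
  let s : Fin d → Fin d := fun i => if h : P i then τ ⟨i, h⟩ else τ.symm ⟨i, h⟩
  have s1 : ∀ i (h : P i), s i = τ ⟨i, h⟩ := fun i h => by simp [s, h]
  have s2 : ∀ i (h : ¬ P i), s i = τ.symm ⟨i, h⟩ := fun i h => by simp [s, h]
  have inv : Function.Involutive s := by
    intro i
    by_cases h : P i
    · rw [s1 i h, s2 _ (τ ⟨i, h⟩).2]; simp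
    · rw [s2 i h, s1 _ (τ.symm ⟨i, h⟩).2]; simp
  have hvs : ∀ i, v (s i) = - v i := by
    intro i
    by_cases h : P i
    · rw [s1 i h, ← hτ ⟨i, h⟩, neg_neg]
    · rw [s2 i h]
      have := hτ (τ.symm ⟨i, h⟩)
      rw [Equiv.apply_symm_apply] at this
      exact this.symm
  refine ⟨inv.toPerm, fun i hi => ?_, inv, hvs⟩
  have h1 := hvs i
  have h2 : s i = i := hi
  rw [h2] at h1
  exact hv i h1

/-- Fourier sum over the configuration. -/
lemma sum_config {d : ℕ} (L : Matrix (Fin 1) (Fin d) ℤ)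
    (f : G → ℂ) (c : AddChar G ℂ → ℂ) (hf : ∀ x, f x = ∑ ψ, c ψ * ψ x) :
    (Fintype.card G : ℂ) * ∑ v ∈ config (G := G) L, ∏ i, f (v i) =
      (Fintype.card G : ℂ) ^ d * ∑ χ : AddChar G ℂ, ∏ i, c (L 0 i • χ) := by
  have h1 : (Fintype.card G : ℂ) * ∑ v ∈ config (G := G) L, ∏ i, f (v i) =
      ∑ v : Fin d → G, (∑ χ : AddChar G ℂ, χ (∑ i, L 0 i • v i)) * ∏ i, f (v i) := by
    simp_rw [AddChar.sum_apply_eq_ite, config, Finset.sum_filter, Finset.mul_sum]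
    refine Finset.sum_congr rfl fun v _ => ?_
    split_ifs <;> simp
  have h2 : ∀ χ : AddChar G ℂ, ∑ x, χ x * f x = Fintype.card G * c (-χ) := by
    intro χ
    simp_rw [hf, Finset.mul_sum]
    rw [Finset.sum_comm]
    have : ∀ ψ : AddChar G ℂ, ∑ x, χ x * (c ψ * ψ x) = c ψ * if χ + ψ = 0 then (Fintype.card G : ℂ) else 0 := by
      intro ψ
      rw [← AddChar.sum_eq_ite, Finset.mul_sum]
      refine Finset.sum_congr rfl fun x _ => ?_
      rw [AddChar.add_apply]; ring
    simp_rw [this]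
    rw [Finset.sum_eq_single (-χ)]
    · simp [mul_comm]
    · intro ψ _ hψ
      rw [if_neg, mul_zero]
      intro h
      exact hψ (eq_neg_of_add_eq_zero_right h)
    · simp
  have h3 : ∀ χ : AddChar G ℂ, ∑ v : Fin d → G, χ (∑ i, L 0 i • v i) * ∏ i, f (v i) =
      (Fintype.card G : ℂ) ^ d * ∏ i, c (L 0 i • (-χ)) := by
    intro χ
    have : ∀ v : Fin d → G, χ (∑ i, L 0 i • v i) * ∏ i, f (v i) =
        ∏ i, ((L 0 i • χ) (v i) * f (v i)) := by
      intro v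
      rw [Finset.prod_mul_distrib]
      congr 1
      simp_rw [AddChar.zsmul_apply, ← AddChar.map_zsmul_eq_zpow]
      exact map_prod χ.toMonoidHom (fun i => Multiplicative.ofAdd (L 0 i • v i)) univ
    simp_rw [this]
    rw [← Fintype.prod_sum (fun (i : Fin d) (x : G) => (L 0 i • χ) x * f x)]
    simp_rw [h2, Finset.prod_mul_distrib]
    simp
  rw [h1]
  simp_rw [Finset.sum_mul]
  rw [Finset.sum_comm]
  simp_rw [h3]
  rw [← Finset.mul_sum]
  congr 1
  exact Equiv.sum_comp (Equiv.neg (AddChar G ℂ)) (fun χ => ∏ i, c (L 0 i • χ))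

lemma cop_zero {A : Type*} [AddCommGroup A] (a : A) {l n : ℤ} (h : IsCoprime l n)
    (hn : n • a = 0) (hl : l • a = 0) : a = 0 := by
  obtain ⟨u, w, huw⟩ := h
  rw [← one_zsmul a, ← huw, add_zsmul, mul_zsmul, mul_zsmul, hn, hl]
  simp

lemma card_zsmul_dual (χ : AddChar G ℂ) : (Fintype.card G : ℤ) • χ = 0 := by
  rw [← AddChar.card_eq (α := G), natCast_zsmul, card_nsmul_eq_zero]

lemma dual_zsmul_zero (m : ℤ) : m • (0 : AddChar G ℂ) = 0 := by
  ext x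
  rw [AddChar.zsmul_apply, AddChar.zero_apply, one_zpow]

lemma tL_eq {d : ℕ} (hd : 0 < d) (L : Matrix (Fin 1) (Fin d) ℤ)
    (hcop : ∀ i, IsCoprime (L 0 i) (Fintype.card G : ℤ))
    (f : G → ℝ) (c : AddChar G ℂ → ℂ) (hf : ∀ x, (f x : ℂ) = ∑ ψ, c ψ * ψ x) :
    (tL L f : ℂ) = ∑ χ : AddChar G ℂ, ∏ i, c (L 0 i • χ) := by
  have hG : (Fintype.card G : ℂ) ≠ 0 := by
    exact_mod_cast Fintype.card_ne_zero
  have h1 := sum_config L (fun x => (f x : ℂ)) c hf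
  have h2 := sum_config (G := G) L (fun _ => 1) (fun ψ => if ψ = 0 then 1 else 0) (by simp)
  have h3 : ∑ χ : AddChar G ℂ, ∏ i, (if L 0 i • χ = 0 then (1 : ℂ) else 0) = 1 := by
    rw [Finset.sum_eq_single 0]
    · exact Finset.prod_eq_one fun i _ => if_pos (dual_zsmul_zero _)
    · intro χ _ hχ
      apply Finset.prod_eq_zero (Finset.mem_univ (⟨0, hd⟩ : Fin d))
      rw [if_neg]
      exact fun h => hχ (cop_zero χ (hcop _) (card_zsmul_dual χ) h)
    · simp
  rw [h3] at h2
  simp only [Finset.prod_const_one, Finset.sum_const, nsmul_eq_mul, mul_one] at h2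
  rw [← h2, mul_assoc] at h1
  have h4 := mul_left_cancel₀ hG h1
  have hC : ((config (G := G) L).card : ℂ) ≠ 0 := by
    intro h
    rw [h, mul_zero] at h2
    exact pow_ne_zero d hG h2.symm
  rw [tL]
  push_cast
  rw [h4]
  field_simp

/-- Main construction from phases. -/
lemma construct {d : ℕ} (hd : 0 < d) (L : Matrix (Fin 1) (Fin d) ℤ)
    (hcop : ∀ i, IsCoprime (L 0 i) (Fintype.card G : ℤ))
    (S : Finset (AddChar G ℂ)) (hS0 : (0 : AddChar G ℂ) ∉ S) (hSneg : ∀ ψ ∈ S, -ψ ∈ S)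
    (hScard : S.card ≤ 2 * d)
    (z : AddChar G ℂ → ℂ) (hz : ∀ ψ, ‖z ψ‖ ≤ 1)
    (hzneg : ∀ ψ, z (-ψ) = (starRingEnd ℂ) (z ψ))
    (hR : (∑ χ ∈ univ.filter (fun χ : AddChar G ℂ => ∀ i, L 0 i • χ ∈ S),
      ∏ i, z (L 0 i • χ)).re ≤ -(1/4)) :
    ∃ f : G → ℝ, (∀ x, f x ∈ Set.Icc (0 : ℝ) 1) ∧ avg f = 1 / 2 ∧
      tL L f ≤ (1 / 2 : ℝ) ^ d -
        1 / (2 ^ (3 * d + 1) * Real.sqrt 2 * (d : ℝ) ^ (2 * d)) := by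
  have hdR : (1 : ℝ) ≤ d := by exact_mod_cast hd
  let a : ℝ := 1 / (4 * d)
  have ha : 0 < a := by positivity
  let c : AddChar G ℂ → ℂ := fun ψ => if ψ = 0 then 1/2 else if ψ ∈ S then a * z ψ else 0
  let g : G → ℂ := fun x => ∑ ψ ∈ S, z ψ * ψ x
  have hgreal : ∀ x, ((g x).re : ℂ) = g x := by
    intro x
    rw [← Complex.conj_eq_iff_re]
    simp only [g, map_sum, map_mul]
    refine Finset.sum_nbij' (fun ψ => -ψ) (fun ψ => -ψ) hSneg hSneg (by simp) (by simp) ?_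
    intro ψ _
    rw [hzneg, AddChar.neg_apply, AddChar.map_neg_eq_conj]
  have hgb : ∀ x, |(g x).re| ≤ 2 * d := by
    intro x
    refine (Complex.abs_re_le_norm _).trans ((norm_sum_le _ _).trans ?_)
    refine (Finset.sum_le_card_nsmul _ _ 1 ?_).trans ?_
    · intro ψ _
      rw [norm_mul, AddChar.norm_apply, mul_one]
      exact hz ψ
    · rw [nsmul_eq_mul, mul_one]
      exact_mod_cast hScard
  let f : G → ℝ := fun x => 1/2 + a * (g x).re
  have hf : ∀ x, (f x : ℂ) = ∑ ψ, c ψ * ψ x := by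
    intro x
    have e1 : ∀ ψ, c ψ * ψ x = (if ψ = 0 then 1/2 else 0) + (if ψ ∈ S then a * (z ψ * ψ x) else 0) := by
      intro ψ
      simp only [c]
      by_cases h : ψ = 0
      · subst h; simp [hS0]
      · simp only [h, if_false, zero_add]
        split_ifs <;> ring
    simp_rw [e1]
    rw [Finset.sum_add_distrib, Finset.sum_ite_eq' , if_pos (mem_univ _), Finset.sum_ite_mem,
      Finset.univ_inter, ← Finset.mul_sum]
    simp only [f]
    push_cast
    rw [hgreal]
  have hac : a * (2 * d) = 1/2 := by
    simp only [a]; field_simp; norm_num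
  refine ⟨f, fun x => ?_, ?_, ?_⟩
  · have h1 := abs_le.1 (hgb x)
    have h2 := mul_le_mul_of_nonneg_left h1.1 ha.le
    have h3 := mul_le_mul_of_nonneg_left h1.2 ha.le
    constructor <;> simp only [f] <;> linarith
  · have hG : (Fintype.card G : ℂ) ≠ 0 := by exact_mod_cast Fintype.card_ne_zero
    have : ((avg f : ℝ) : ℂ) = ((1/2 : ℝ) : ℂ) := by
      rw [avg]
      push_cast
      simp_rw [hf]
      rw [Finset.sum_comm]
      simp_rw [← Finset.mul_sum, AddChar.sum_eq_ite]
      simp [c, hG]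
    exact_mod_cast this
  · have ht := tL_eq hd L hcop f c hf
    have hne : ∀ (χ : AddChar G ℂ) i, χ ≠ 0 → L 0 i • χ ≠ 0 := fun χ i hχ h =>
      hχ (cop_zero χ (hcop _) (card_zsmul_dual χ) h)
    have e2 : ∀ χ : AddChar G ℂ, ∏ i, c (L 0 i • χ) = (if χ = 0 then (1/2 : ℂ)^d else 0) +
        (if ∀ i, L 0 i • χ ∈ S then (a : ℂ)^d * ∏ i, z (L 0 i • χ) else 0) := by
      intro χ
      by_cases h : χ = 0
      · subst h
        have : ¬ (∀ i : Fin d, L 0 i • (0 : AddChar G ℂ) ∈ S) := by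
          intro h
          have := h ⟨0, hd⟩
          rw [dual_zsmul_zero] at this
          exact hS0 this
        rw [if_neg this]
        have e4 : ∀ i : Fin d, c (L 0 i • (0 : AddChar G ℂ)) = 1/2 := fun i => by
          rw [dual_zsmul_zero]; simp [c]
        rw [Finset.prod_congr rfl (fun i _ => e4 i)]
        simp
      · rw [if_neg h, zero_add]
        have e3 : ∀ i, c (L 0 i • χ) = if L 0 i • χ ∈ S then a * z (L 0 i • χ) else 0 := by
          intro i
          simp only [c]
          rw [if_neg (hne χ i h)]
        split_ifs with hall
        · simp_rw [e3, hall, if_true]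
          rw [Finset.prod_mul_distrib]; simp
        · push Not at hall
          obtain ⟨i, hi⟩ := hall
          apply Finset.prod_eq_zero (mem_univ i)
          rw [e3, if_neg hi]
    simp_rw [e2] at ht
    rw [Finset.sum_add_distrib, Finset.sum_ite_eq', if_pos (mem_univ _), ← Finset.sum_filter,
      ← Finset.mul_sum] at ht
    have hre := congrArg Complex.re ht
    have q1 : ((1/2 : ℂ)^d) = (((1/2 : ℝ)^d : ℝ) : ℂ) := by push_cast; rfl
    rw [q1, ← Complex.ofReal_pow, Complex.add_re, Complex.re_ofReal_mul, Complex.ofReal_re,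
      Complex.ofReal_re] at hre
    rw [hre]
    have had : 0 < a ^ d := by positivity
    have h5 := mul_le_mul_of_nonneg_left hR had.le
    have h6 : 1 / (2 ^ (3 * d + 1) * Real.sqrt 2 * (d : ℝ) ^ (2 * d)) ≤ a ^ d * (1/4) := by
      have : a ^ d * (1/4) = 1 / (4 * (4 ^ d * (d:ℝ)^d)) := by
        simp only [a]
        rw [div_pow, mul_pow]
        field_simp
        norm_num
      rw [this]
      apply one_div_le_one_div_of_le (by positivity)
      have s2 : 1 ≤ Real.sqrt 2 := by
        rw [Real.one_le_sqrt]; norm_num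
      have p1 : (2:ℝ) ≤ 2 ^ d := by
        calc (2:ℝ) = 2^1 := by norm_num
          _ ≤ 2^d := pow_le_pow_right₀ (by norm_num) hd
      have p2 : (d:ℝ)^d ≤ (d:ℝ)^(2*d) := pow_le_pow_right₀ hdR (by omega)
      have p3 : (2:ℝ)^(3*d+1) = 2^d * (2 * 4^d) := by
        rw [show (4:ℝ) = 2^2 by norm_num, ← pow_mul]; ring
      calc 4 * (4 ^ d * (d:ℝ)^d) = (2 * (2 * 4^d)) * 1 * (d:ℝ)^d := by ring
        _ ≤ (2^d * (2 * 4^d)) * Real.sqrt 2 * (d:ℝ)^(2*d) := by gcongr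
        _ = _ := by rw [p3]
    linarith

lemma exists_char : ∃ χ₀ : AddChar G ℂ, ∀ m : ℤ, m • χ₀ = 0 → ∀ x : G, m • x = 0 := by
  have hE : AddMonoid.ExponentExists (AddChar G ℂ) := AddMonoid.ExponentExists.of_finite
  obtain ⟨χ₀, h⟩ := AddMonoid.exists_addOrderOf_eq_exponent hE
  refine ⟨χ₀, fun m hm x => ?_⟩
  rw [← addOrderOf_dvd_iff_zsmul_eq_zero, h] at hm
  rw [← AddChar.forall_apply_eq_zero]
  intro ψ
  have h1 : m • ψ = 0 := by
    rw [← addOrderOf_dvd_iff_zsmul_eq_zero]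
    exact (Int.natCast_dvd_natCast.2 (AddMonoid.addOrder_dvd_exponent ψ)).trans hm
  rw [AddChar.map_zsmul_eq_zpow, ← AddChar.zsmul_apply, h1, AddChar.zero_apply]

end helpers

/-- If `|G| > 1`, all coefficients of `L ∈ ℤ^{1×d}` are coprime to `|G|` and `L` admits no
canceling partition in `G` (in particular this holds whenever `d` is odd), then there is a
function `f : G → [0,1]` with `E(f) = 1/2` and
`t_L(f) ≤ (1/2)^d − 1/(2^{3d+1}·√2·d^{2d})`. -/
theorem explicit_deviation_bound {d : ℕ} (L : Matrix (Fin 1) (Fin d) ℤ)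
    (hG : 1 < Fintype.card G)
    (hcop : ∀ i, IsCoprime (L 0 i) (Fintype.card G : ℤ))
    (hpart : ¬ HasCancelingPartition G L) :
    ∃ f : G → ℝ, (∀ x, f x ∈ Set.Icc (0 : ℝ) 1) ∧ avg f = 1 / 2 ∧
      tL L f ≤ (1 / 2 : ℝ) ^ d -
        1 / (2 ^ (3 * d + 1) * Real.sqrt 2 * (d : ℝ) ^ (2 * d)) := by
  classical
  have hd : 0 < d := by
    rcases Nat.eq_zero_or_pos d with h | h
    · subst h
      exact absurd ⟨Equiv.refl _, fun i => i.elim0, fun i => i.elim0, fun i => i.elim0⟩ hpart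
    · exact h
  obtain ⟨x₀, hx₀⟩ : ∃ x : G, x ≠ 0 := by
    have := Fintype.one_lt_card_iff_nontrivial.1 hG
    exact exists_ne 0
  obtain ⟨χ₀, hχ⟩ := exists_char (G := G)
  have hχ0 : χ₀ ≠ 0 := by
    intro h
    have := hχ 1 (by simp [h]) x₀
    rw [one_zsmul] at this
    exact hx₀ this
  have hc : ∀ (χ : AddChar G ℂ) i, L 0 i • χ = 0 → χ = 0 := fun χ i h =>
    cop_zero χ (hcop i) (card_zsmul_dual χ) h
  let S : Finset (AddChar G ℂ) := univ.image (fun j => L 0 j • χ₀) ∪ univ.image (fun j => -(L 0 j • χ₀))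
  have memS : ∀ ψ, ψ ∈ S ↔ (∃ j, L 0 j • χ₀ = ψ) ∨ ∃ j, -(L 0 j • χ₀) = ψ := by
    intro ψ; simp [S]
  have hS0 : (0 : AddChar G ℂ) ∉ S := by
    rw [memS]
    rintro (⟨j, hj⟩ | ⟨j, hj⟩)
    · exact hχ0 (hc _ _ hj)
    · exact hχ0 (hc _ _ (neg_eq_zero.1 hj))
  have hSneg : ∀ ψ ∈ S, -ψ ∈ S := by
    intro ψ h
    rw [memS] at h ⊢
    rcases h with ⟨j, hj⟩ | ⟨j, hj⟩
    · exact Or.inr ⟨j, by rw [hj]⟩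
    · exact Or.inl ⟨j, by rw [← hj, neg_neg]⟩
  have hScard : S.card ≤ 2 * d := by
    refine (Finset.card_union_le _ _).trans ?_
    have h1 := Finset.card_image_le (s := (univ : Finset (Fin d))) (f := fun j => L 0 j • χ₀)
    have h2 := Finset.card_image_le (s := (univ : Finset (Fin d))) (f := fun j => -(L 0 j • χ₀))
    rw [Finset.card_fin] at h1 h2
    omega
  have hmem0 : χ₀ ∈ univ.filter (fun χ : AddChar G ℂ => ∀ i, L 0 i • χ ∈ S) := by
    simp only [mem_filter, mem_univ, true_and]
    exact fun i => (memS _).2 (Or.inl ⟨i, rfl⟩)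
  by_cases h2 : ∀ x : G, (2 : ℤ) • x = 0
  · have hodd : ∀ i, Odd (L 0 i) := by
      intro i
      rw [← Int.not_even_iff_odd]
      rintro ⟨r, hr⟩
      apply hx₀
      apply cop_zero x₀ (hcop i)
      · rw [natCast_zsmul, card_nsmul_eq_zero]
      · rw [hr, ← mul_two, mul_zsmul, h2, smul_zero]
    have hdo : Odd d := by
      rw [← Nat.not_even_iff_odd]
      rintro ⟨r, hr⟩
      refine hpart ⟨Fin.revPerm, fun i hi => ?_, fun i => by simp, fun i x => ?_⟩
      · have := congrArg Fin.val hi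
        simp [Fin.val_rev] at this
        omega
      · obtain ⟨s, hs⟩ := (hodd i).add_odd (hodd (Fin.revPerm i))
        rw [hs, ← mul_two, mul_zsmul, h2, smul_zero]
    refine construct hd L hcop S hS0 hSneg hScard (fun _ => -1) (by simp) (by simp) ?_
    simp only [Finset.prod_const, Finset.card_fin, hdo.neg_one_pow, Finset.sum_const]
    have : 1 ≤ (univ.filter (fun χ : AddChar G ℂ => ∀ i, L 0 i • χ ∈ S)).card :=
      Finset.card_pos.2 ⟨_, hmem0⟩
    have h3 : (1 : ℝ) ≤ (univ.filter (fun χ : AddChar G ℂ => ∀ i, L 0 i • χ ∈ S)).card := by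
      exact_mod_cast this
    simp only [nsmul_eq_mul, mul_neg, mul_one, Complex.neg_re, Complex.natCast_re]
    linarith
  · obtain ⟨k, hkneg, hk⟩ := exists_weight (D := AddChar G ℂ) d
    have hK : ∀ χ ∈ univ.filter (fun χ : AddChar G ℂ => ∀ i, L 0 i • χ ∈ S),
        ∑ i, k (L 0 i • χ) ≠ 0 := by
      intro χ hχS hsum
      simp only [mem_filter, mem_univ, true_and] at hχS
      have ann : ∀ m : ℤ, m • χ = 0 → ∀ x : G, m • x = 0 := by
        intro m hm
        apply hχ
        rcases (memS _).1 (hχS ⟨0, hd⟩) with ⟨j, hj⟩ | ⟨j, hj⟩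
        · apply hc _ j
          rw [smul_comm, hj, smul_comm, hm, dual_zsmul_zero]
        · apply hc _ j
          rw [smul_comm, ← neg_eq_zero, ← zsmul_neg, hj, smul_comm, hm, dual_zsmul_zero]
      obtain ⟨σ, s1, s2, s3⟩ := hk (fun i => L 0 i • χ) (fun i hi => h2 (ann 2 (by
        apply hc _ i
        rw [smul_comm, two_zsmul]
        exact add_eq_zero_iff_eq_neg.2 hi))) hsum
      refine hpart ⟨σ, s1, s2, fun i => ann _ ?_⟩
      rw [add_zsmul, s3 i, add_neg_cancel]
    obtain ⟨t, ht⟩ := exists_phase _ _ hK χ₀ hmem0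
    refine construct hd L hcop S hS0 hSneg hScard
      (fun ψ => Complex.exp (((k ψ * t : ℝ) : ℂ) * Complex.I)) ?_ ?_ ?_
    · intro ψ
      rw [Complex.norm_exp_ofReal_mul_I]
    · intro ψ
      rw [← Complex.exp_conj, hkneg]
      simp
    · rw [Complex.re_sum]
      convert ht using 2 with χ _
      rw [← Complex.exp_sum, ← Finset.sum_mul, ← Complex.ofReal_sum, Complex.exp_ofReal_mul_I_re,
        ← Finset.sum_mul]
      push_cast
      rfl
end
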